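/- arXiv:2405.19395 — 3 statements merged into one kernel-verified Lean document; each statement's English description precedes it below -/
import Mathlib

section
/- Let α ∈ ℂ and let Λ be the additive subgroup of ℂ × ℂ generated by the four elements (1,0), (0,1), (i,0), and (α,i). Then the following are equivalent: (a) there exist e = (e₁,e₂) ∈ Λ with e₂ ≠ 0 and λ ∈ ℂ with Im λ ≠ 0 such that (λ·e₁, λ·e₂) ∈ Λ; (b) there exist rational numbers p and q with α = p + q·i. (This is the criterion for the rank-2 complex torus with period matrix ((1,0,i,α),(0,1,0,i)) to be decomposable, i.e., to admit a second complex subtorus besides the obvious one.) -/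
/-- Coordinates of the elements of the lattice generated by `(1,0), (0,1), (i,0), (α,i)`. -/
theorem mem_closure_period_iff (α : ℂ) (x : ℂ × ℂ) :
    x ∈ AddSubgroup.closure
      {((1 : ℂ), (0 : ℂ)), ((0 : ℂ), (1 : ℂ)), (Complex.I, (0 : ℂ)), (α, Complex.I)} ↔
    ∃ a b c d : ℤ, x = (a + c * Complex.I + d * α, b + d * Complex.I) := by
  constructor
  · intro hx
    induction hx using AddSubgroup.closure_induction with
    | mem x hx =>
      simp only [Set.mem_insert_iff, Set.mem_singleton_iff] at hx
      rcases hx with rfl | rfl | rfl | rfl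
      · exact ⟨1, 0, 0, 0, by simp⟩
      · exact ⟨0, 1, 0, 0, by simp⟩
      · exact ⟨0, 0, 1, 0, by simp⟩
      · exact ⟨0, 0, 0, 1, by simp⟩
    | zero => exact ⟨0, 0, 0, 0, by ext <;> simp⟩
    | add x y _ _ hx hy =>
      obtain ⟨a, b, c, d, rfl⟩ := hx
      obtain ⟨a', b', c', d', rfl⟩ := hy
      refine ⟨a + a', b + b', c + c', d + d', ?_⟩
      ext1 <;> push_cast <;> simp only [Prod.fst_add, Prod.snd_add] <;> ring
    | neg x _ hx =>
      obtain ⟨a, b, c, d, rfl⟩ := hx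
      refine ⟨-a, -b, -c, -d, ?_⟩
      ext1 <;> push_cast <;> simp only [Prod.fst_neg, Prod.snd_neg] <;> ring
  · rintro ⟨a, b, c, d, rfl⟩
    have key : ((a + c * Complex.I + d * α, b + d * Complex.I) : ℂ × ℂ) =
        a • ((1 : ℂ), (0 : ℂ)) + b • ((0 : ℂ), (1 : ℂ)) + c • (Complex.I, (0 : ℂ)) +
          d • (α, Complex.I) := by
      ext1 <;> simp
    rw [key]
    refine add_mem (add_mem (add_mem ?_ ?_) ?_) ?_ <;>
      exact zsmul_mem (AddSubgroup.subset_closure (by simp)) _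

/-- Decomposability criterion for the rank-2 complex torus with period matrix
`((1,0,i,α),(0,1,0,i))`: the lattice `Λ ⊆ ℂ²` generated by `(1,0), (0,1), (i,0), (α,i)` admits
a vector `e` with `e₂ ≠ 0` and a non-real `λ` with `λ·e ∈ Λ` iff `α ∈ ℚ(i)`. -/
theorem stmt_5 (α : ℂ)
    (Λ : AddSubgroup (ℂ × ℂ))
    (hΛ : Λ = AddSubgroup.closure
      {((1 : ℂ), (0 : ℂ)), ((0 : ℂ), (1 : ℂ)), (Complex.I, (0 : ℂ)), (α, Complex.I)}) :
    (∃ e ∈ Λ, e.2 ≠ 0 ∧ ∃ l : ℂ, l.im ≠ 0 ∧ (l * e.1, l * e.2) ∈ Λ) ↔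
      ∃ p q : ℚ, α = (p : ℂ) + (q : ℂ) * Complex.I := by
  subst hΛ
  simp only [mem_closure_period_iff]
  constructor
  · rintro ⟨e, ⟨a, b, c, d, rfl⟩, hw, l, hl, a', b', c', d', h⟩
    obtain ⟨h1, h2⟩ := Prod.mk.inj h
    simp only at h1 h2 hw
    have hD : b' * d - b * d' ≠ 0 := by
      intro h0
      have h0' : (b' : ℝ) * d - b * d' = 0 := by exact_mod_cast h0
      have hre := congrArg Complex.re h2
      have him := congrArg Complex.im h2
      simp at hre him
      have h3 : l.im * ((b : ℝ) ^ 2 + (d : ℝ) ^ 2) = 0 := by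
        linear_combination (b : ℝ) * him - d * hre - h0'
      have h4 : (b : ℝ) ^ 2 + (d : ℝ) ^ 2 = 0 := (mul_eq_zero.mp h3).resolve_left hl
      have hb : (b : ℝ) = 0 := by nlinarith [sq_nonneg (b : ℝ), sq_nonneg (d : ℝ)]
      have hd : (d : ℝ) = 0 := by nlinarith [sq_nonneg (b : ℝ), sq_nonneg (d : ℝ)]
      norm_cast at hb hd
      simp [hb, hd] at hw
    have hDC : (b' : ℂ) * d - b * d' ≠ 0 := by exact_mod_cast hD
    refine ⟨((b * a' - d * c' - b' * a + d' * c : ℤ) : ℚ) / ((b' * d - b * d' : ℤ) : ℚ),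
      ((b * c' + d * a' - b' * c - d' * a : ℤ) : ℚ) / ((b' * d - b * d' : ℤ) : ℚ), ?_⟩
    push_cast
    rw [div_mul_eq_mul_div, ← add_div, eq_div_iff hDC]
    linear_combination (b + d * Complex.I) * h1 - (a + c * Complex.I + d * α) * h2 +
      (d * c' - d' * c : ℂ) * Complex.I_sq
  · rintro ⟨p, q, rfl⟩
    have hp : (p : ℂ) * p.den = p.num := by exact_mod_cast Rat.mul_den_eq_num p
    have hq : (q : ℂ) * q.den = q.num := by exact_mod_cast Rat.mul_den_eq_num q
    refine ⟨(0, (p.den * q.den : ℤ)), ⟨0, p.den * q.den, 0, 0, by simp⟩, by simp, Complex.I,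
      by simp, -(p.num * q.den), 0, -(q.num * p.den), p.den * q.den, ?_⟩
    ext1
    · push_cast
      linear_combination -(q.den : ℂ) * hp - (p.den : ℂ) * Complex.I * hq
    · push_cast
      ring
end

section
/- Let Λ be the additive subgroup of ℂ generated by 1 and i·√3. Then {λ ∈ ℂ : for all z ∈ Λ, λ·z ∈ Λ} = Λ. (This is the statement that the endomorphism ring of the elliptic curve E_{i√3} is the non-principal order ℤ[i√3] of ℚ(√−3).) -/
/-- The endomorphism ring of `E_{i√3}` is the (non-principal) order `ℤ[i√3]`:
the multiplier set of the lattice `Λ = ⟨1, i√3⟩` equals `Λ` itself. -/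
theorem stmt_9 (Λ : AddSubgroup ℂ)
    (hΛ : Λ = AddSubgroup.closure {1, Complex.I * Real.sqrt 3}) :
    {l : ℂ | ∀ z ∈ Λ, l * z ∈ Λ} = (Λ : Set ℂ) := by
  have mem_iff (z : ℂ) : z ∈ Λ ↔ ∃ m n : ℤ, m + n * (Complex.I * Real.sqrt 3) = z := by
    simp [hΛ, AddSubgroup.mem_closure_pair]
  have sq_eq : (Complex.I * Real.sqrt 3) ^ 2 = -3 := by
    rw [mul_pow, Complex.I_sq, ← Complex.ofReal_pow, Real.sq_sqrt (by norm_num)]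
    norm_num
  ext l
  simp only [Set.mem_ofPred_eq, SetLike.mem_coe]
  refine ⟨fun h => ?_, fun hl z hz => ?_⟩
  · simpa using h 1 ((mem_iff 1).2 ⟨1, 0, by simp⟩)
  · obtain ⟨a, b, rfl⟩ := (mem_iff l).1 hl
    obtain ⟨c, d, rfl⟩ := (mem_iff z).1 hz
    refine (mem_iff _).2 ⟨a * c - 3 * b * d, a * d + b * c, ?_⟩
    push_cast
    linear_combination -(b * d : ℂ) * sq_eq
end

section
/- Let r ≥ 1, let U ⊆ ℂ^r be open, and let a, c : U → ℂ be holomorphic (complex differentiable on U). Suppose that for every u ∈ U and all indices j, k, the partial derivatives satisfy (∂ⱼ a)(u) · (∂ₖ c)(u) = (∂ₖ a)(u) · (∂ⱼ c)(u). Let u₀ ∈ U be a point at which the differential of a is nonzero (i.e., ∂ⱼ a(u₀) ≠ 0 for some j). Then there exist an open neighborhood V ⊆ U of u₀, an open set W ⊆ ℂ with a(V) ⊆ W, and a holomorphic function g : W → ℂ such that c(u) = g(a(u)) for all u ∈ V. (This is the local integrability statement used in the paper to conclude that the Weierstrass coefficients c_n^ℓ, and hence the modulus Z^ℓ, of each rank-1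 torus factor of a completely split special Kähler geometry depend on the single special coordinate a_ℓ alone.) -/
open Metric Set Filter Topology

section ContDiff

variable {E F : Type*} [NormedAddCommGroup E] [NormedSpace ℂ E]
  [NormedAddCommGroup F] [NormedSpace ℂ F]

/-- A complex differentiable map which stays within distance `1` of a fixed value on a ball has
Fréchet derivative that is continuous on a smaller ball. -/
theorem continuousOn_fderiv_ball_of_mapsTo {f : E → F} {x₀ : E} {q : F} {R : ℝ} (hR : 0 < R)
    (hd : DifferentiableOn ℂ f (ball x₀ (3 * R)))
    (hmaps : MapsTo f (ball x₀ (3 * R)) (closedBall q 1)) :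
    ContinuousOn (fderiv ℂ f) (ball x₀ R) := by
  have hsub : ∀ {x s t}, x ∈ ball x₀ s → s + R ≤ t → ball x R ⊆ ball x₀ t := fun hx hst ↦
    ball_subset_ball' (by linarith [mem_ball.1 hx])
  have hdiff : ∀ x ∈ ball x₀ (3 * R), DifferentiableAt ℂ f x := fun x hx ↦
    hd.differentiableAt (isOpen_ball.mem_nhds hx)
  have hbound : ∀ x ∈ ball x₀ (2 * R), ‖fderiv ℂ f x‖ ≤ 2 / R := by
    intro x hx
    have hs : ball x R ⊆ ball x₀ (3 * R) := hsub hx (by linarith)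
    refine Complex.norm_fderiv_le_div_of_mapsTo_ball (hd.mono hs) (fun y hy ↦ ?_) hR
    have h1 := mem_closedBall.1 (hmaps (hs hy))
    have h2 := mem_closedBall.1 (hmaps (hs (mem_ball_self hR)))
    have := dist_triangle_right (f y) (f x) q
    exact mem_closedBall.2 (by linarith)
  have hlip : ∀ x ∈ ball x₀ (2 * R), ∀ y ∈ ball x₀ (2 * R),
      ‖f y - f x‖ ≤ 2 / R * ‖y - x‖ := by
    let : NormedSpace ℝ E := NormedSpace.restrictScalars ℝ ℂ E
    intro x hx y hy
    exact (convex_ball x₀ (2 * R)).norm_image_sub_le_of_norm_fderiv_le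
      (fun z hz ↦ hdiff z (ball_subset_ball (by linarith) hz)) hbound hx hy
  have hlip' : ∀ x ∈ ball x₀ R, ∀ y ∈ ball x₀ R,
      dist (fderiv ℂ f x) (fderiv ℂ f y) ≤ (4 / R / R) * dist x y := by
    intro x hx y hy
    have htrans : ∀ u ∈ ball x₀ R, ∀ z ∈ ball (0 : E) R, z + u ∈ ball x₀ (2 * R) := by
      intro u hu z hz
      refine hsub hu (by linarith) ?_
      simpa using hz
    have hmem : ∀ u ∈ ball x₀ R, ∀ z ∈ ball (0 : E) R, DifferentiableAt ℂ f (z + u) :=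
      fun u hu z hz ↦ hdiff _ (ball_subset_ball (by linarith) (htrans u hu z hz))
    have h0 : (0 : E) ∈ ball (0 : E) R := mem_ball_self hR
    have key := Complex.norm_fderiv_le_div_of_mapsTo_ball (c := (0 : E)) (R₁ := R)
      (R₂ := 4 / R * dist x y) (f := fun z ↦ f (z + x) - f (z + y))
      (fun z hz ↦ DifferentiableAt.differentiableWithinAt <|
        ((differentiableAt_comp_add_right x).2 (hmem x hx z hz)).sub
          ((differentiableAt_comp_add_right y).2 (hmem y hy z hz)))
      (fun z hz ↦ by
        have h1 := hlip _ (htrans y hy z hz) _ (htrans x hx z hz)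
        have h2 := hlip _ (htrans y hy 0 h0) _ (htrans x hx 0 h0)
        rw [add_sub_add_left_eq_sub] at h1 h2
        rw [mem_closedBall, dist_eq_norm, dist_eq_norm]
        refine (norm_sub_le _ _).trans ((add_le_add h1 h2).trans_eq ?_)
        ring) hR
    rw [fderiv_fun_sub ((differentiableAt_comp_add_right x).2 (hmem x hx 0 h0))
      ((differentiableAt_comp_add_right y).2 (hmem y hy 0 h0)), fderiv_comp_add_right,
      fderiv_comp_add_right, zero_add, zero_add] at key
    rw [dist_eq_norm (fderiv ℂ f x)]
    exact key.trans_eq (by ring)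
  exact (LipschitzOnWith.of_dist_le_mul (K := ⟨4 / R / R, by positivity⟩) hlip').continuousOn

/-- A complex differentiable map on an open subset of a complex normed space is `C¹`. -/
theorem DifferentiableOn.contDiffAt_one_of_mem_nhds {f : E → F} {s : Set E} {x₀ : E}
    (hd : DifferentiableOn ℂ f s) (hs : s ∈ 𝓝 x₀) : ContDiffAt ℂ 1 f x₀ := by
  have hcont : ∀ᶠ x in 𝓝 x₀, f x ∈ closedBall (f x₀) 1 :=
    (hd.differentiableAt hs).continuousAt.eventually_mem (closedBall_mem_nhds _ one_pos)
  obtain ⟨ε, hε, hball⟩ := Metric.mem_nhds_iff.1 (inter_mem hs hcont)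
  have h3 : 3 * (ε / 3) = ε := by ring
  refine contDiffAt_one_iff.2 ⟨fderiv ℂ f, ball x₀ (ε / 3), ball_mem_nhds _ (by positivity),
    continuousOn_fderiv_ball_of_mapsTo (q := f x₀) (by positivity) ?_ ?_, fun x hx ↦ ?_⟩
  · rw [h3]
    exact hd.mono fun x hx ↦ (hball hx).1
  · rw [h3]
    exact fun x hx ↦ (hball hx).2
  · have hx' : x ∈ ball x₀ ε := ball_subset_ball (by linarith) hx
    exact (hd.differentiableAt (mem_of_superset (isOpen_ball.mem_nhds hx')
      fun y hy ↦ (hball hy).1)).hasFDerivAt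

end ContDiff

section Coordinates

variable {ι : Type*} [Fintype ι] [DecidableEq ι]

/-- Replacing the `j`-th coordinate functional of the identity by a functional `A` with
`A eⱼ ≠ 0` gives an invertible map. -/
noncomputable def replaceCoordEquiv (j : ι) (A : (ι → ℂ) →L[ℂ] ℂ)
    (hA : A (Pi.single j 1) ≠ 0) : (ι → ℂ) ≃L[ℂ] (ι → ℂ) :=
  ContinuousLinearEquiv.equivOfInverse
    (.id ℂ _ + (A - .proj j).smulRight (Pi.single j 1))
    (.id ℂ _ + ((A (Pi.single j 1))⁻¹ • (.proj j - A)).smulRight (Pi.single j 1))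
    (fun v ↦ by
      ext k
      by_cases hk : k = j
      · subst hk
        simp
        field_simp
        ring
      · simp [hk])
    (fun v ↦ by
      ext k
      by_cases hk : k = j
      · subst hk
        simp
        field_simp
        ring
      · simp [hk])

/-- Proportionality of two functionals on the standard basis extends to all vectors. -/
theorem mul_eq_mul_of_forall_single {A C : (ι → ℂ) →L[ℂ] ℂ}
    (h : ∀ j k, A (Pi.single j 1) * C (Pi.single k 1) = A (Pi.single k 1) * C (Pi.single j 1))
    (v w : ι → ℂ) : A v * C w = A w * C v := by
  have expand : ∀ (L : (ι → ℂ) →L[ℂ] ℂ) (x : ι → ℂ), L x = ∑ i, x i * L (Pi.single i 1) := by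
    intro L x
    conv_lhs => rw [pi_eq_sum_univ' x]
    simp [map_sum]
  rw [expand A v, expand C w, expand A w, expand C v, Finset.sum_mul_sum, Finset.sum_mul_sum,
    Finset.sum_comm]
  refine Finset.sum_congr rfl fun k _ ↦ Finset.sum_congr rfl fun j _ ↦ ?_
  linear_combination v j * w k * h j k

/-- Fixing the `j`-th coordinate is differentiable, with derivative killing `eⱼ`. -/
theorem hasFDerivAt_update_left (j : ι) (z : ℂ) (y : ι → ℂ) :
    HasFDerivAt (fun y : ι → ℂ ↦ Function.update y j z)
      (.id ℂ _ - (ContinuousLinearMap.proj j : (ι → ℂ) →L[ℂ] ℂ).smulRight (Pi.single j 1)) y := by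
  have : (fun y : ι → ℂ ↦ Function.update y j z) = fun y ↦
      (.id ℂ _ - (ContinuousLinearMap.proj j : (ι → ℂ) →L[ℂ] ℂ).smulRight (Pi.single j 1) :
        (ι → ℂ) →L[ℂ] (ι → ℂ)) y
        + Pi.single j z := by
    ext y k
    by_cases hk : k = j
    · subst hk
      simp
    · simp [hk]
  rw [this]
  exact (ContinuousLinearMap.hasFDerivAt _).add_const _

theorem update_mem_ball {j : ι} {y w : ι → ℂ} {z : ℂ} {ε : ℝ}
    (hy : y ∈ ball w ε) (hz : z ∈ ball (w j) ε) : Function.update y j z ∈ ball w ε := by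
  have hε : 0 < ε := dist_nonneg.trans_lt (mem_ball.1 hz)
  rw [mem_ball, dist_pi_lt_iff hε] at hy ⊢
  intro k
  by_cases hk : k = j
  · subst hk
    simpa using hz
  · simpa [hk] using hy k

/-- A differentiable function on a ball whose derivative kills all vectors with vanishing `j`-th
coordinate depends only on the `j`-th coordinate. -/
theorem eq_apply_update_of_fderiv_eq_zero {h : (ι → ℂ) → ℂ} {w₀ : ι → ℂ} {ε : ℝ} {j : ι}
    (hd : ∀ w ∈ ball w₀ ε, DifferentiableAt ℂ h w)
    (hz : ∀ w ∈ ball w₀ ε, ∀ v : ι → ℂ, v j = 0 → fderiv ℂ h w v = 0)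
    {w : ι → ℂ} (hw : w ∈ ball w₀ ε) : h w = h (Function.update w₀ j (w j)) := by
  have hε : 0 < ε := dist_nonneg.trans_lt (mem_ball.1 hw)
  have hwj : w j ∈ ball (w₀ j) ε := (dist_le_pi_dist w w₀ j).trans_lt hw
  have hder : ∀ y ∈ ball w₀ ε,
      HasFDerivAt (fun y ↦ h (Function.update y j (w j))) (0 : (ι → ℂ) →L[ℂ] ℂ) y := by
    intro y hy
    have hm := update_mem_ball hy hwj
    convert! (hd _ hm).hasFDerivAt.comp y (hasFDerivAt_update_left j (w j) y) using 1
    ext1 v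
    exact (hz _ hm _ (by simp)).symm
  have := isOpen_ball.is_const_of_fderiv_eq_zero (convex_ball w₀ ε).isPreconnected
    (fun y hy ↦ (hder y hy).differentiableAt.differentiableWithinAt)
    (fun y hy ↦ (hder y hy).fderiv) hw (mem_ball_self hε)
  simpa using this

end Coordinates

/-- Local integrability: if `a, c : U → ℂ` are holomorphic on an open `U ⊆ ℂʳ` with
proportional differentials, `(∂ⱼa)(∂ₖc) = (∂ₖa)(∂ⱼc)`, and the differential of `a` is nonzero
at `u₀ ∈ U`, then near `u₀` one has `c = g ∘ a` for some holomorphic `g`. -/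
theorem stmt_12 (r : ℕ) (hr : 1 ≤ r)
    (U : Set (Fin r → ℂ)) (hU : IsOpen U)
    (a c : (Fin r → ℂ) → ℂ)
    (ha : DifferentiableOn ℂ a U) (hc : DifferentiableOn ℂ c U)
    (hprop : ∀ u ∈ U, ∀ j k : Fin r,
      fderiv ℂ a u (Pi.single j 1) * fderiv ℂ c u (Pi.single k 1) =
        fderiv ℂ a u (Pi.single k 1) * fderiv ℂ c u (Pi.single j 1))
    (u₀ : Fin r → ℂ) (hu₀ : u₀ ∈ U)
    (hnz : ∃ j : Fin r, fderiv ℂ a u₀ (Pi.single j 1) ≠ 0) :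
    ∃ V : Set (Fin r → ℂ), IsOpen V ∧ u₀ ∈ V ∧ V ⊆ U ∧
      ∃ W : Set ℂ, IsOpen W ∧ a '' V ⊆ W ∧
        ∃ g : ℂ → ℂ, DifferentiableOn ℂ g W ∧ ∀ u ∈ V, c u = g (a u) := by
  obtain ⟨j, hj⟩ := hnz
  have haC : ContDiffAt ℂ 1 a u₀ := ha.contDiffAt_one_of_mem_nhds (hU.mem_nhds hu₀)
  set Φ : (Fin r → ℂ) → (Fin r → ℂ) := fun u ↦ u + (a u - u j) • Pi.single j (1 : ℂ) with hΦ
  have hΦj : ∀ u, Φ u j = a u := fun u ↦ by simp [hΦ]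
  have hΦC : ContDiffAt ℂ 1 Φ u₀ :=
    contDiffAt_id.add ((haC.sub (contDiff_apply ℂ ℂ j).contDiffAt).smul contDiffAt_const)
  have hΦ' : HasFDerivAt Φ
      (replaceCoordEquiv j (fderiv ℂ a u₀) hj : (Fin r → ℂ) →L[ℂ] (Fin r → ℂ)) u₀ :=
    (hasFDerivAt_id u₀).fun_add
      (((haC.differentiableAt one_ne_zero).hasFDerivAt.fun_sub
        (hasFDerivAt_apply j u₀)).smul_const _)
  have hstrict := hΦC.hasStrictFDerivAt' hΦ' one_ne_zero
  set Ψ := hΦC.localInverse hΦ' one_ne_zero with hΨ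
  have hΨC : ContDiffAt ℂ 1 Ψ (Φ u₀) := hΦC.to_localInverse hΦ' one_ne_zero
  have hΨ0 : Ψ (Φ u₀) = u₀ := hΦC.localInverse_apply_image hΦ' one_ne_zero
  have hleft : ∀ᶠ u in 𝓝 u₀, Ψ (Φ u) = u := hstrict.eventually_left_inverse
  have hright : ∀ᶠ w in 𝓝 (Φ u₀), Φ (Ψ w) = w := hstrict.eventually_right_inverse
  have hΨU : ∀ᶠ w in 𝓝 (Φ u₀), Ψ w ∈ U :=
    hΨC.continuousAt.eventually_mem (by rw [hΨ0]; exact hU.mem_nhds hu₀)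
  have hΨd : ∀ᶠ w in 𝓝 (Φ u₀), DifferentiableAt ℂ Ψ w :=
    (hΨC.eventually (by simp)).mono fun w hw ↦ hw.differentiableAt one_ne_zero
  obtain ⟨ε, hε, hB⟩ := Metric.eventually_nhds_iff_ball.1 (hright.and (hΨU.and hΨd))
  have haΨ : ∀ w ∈ ball (Φ u₀) ε, a (Ψ w) = w j := fun w hw ↦ by
    rw [← hΦj, (hB w hw).1]
  have hcΨ : ∀ w ∈ ball (Φ u₀) ε,
      HasFDerivAt (fun w ↦ c (Ψ w)) ((fderiv ℂ c (Ψ w)).comp (fderiv ℂ Ψ w)) w := fun w hw ↦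
    (hc.differentiableAt (hU.mem_nhds (hB w hw).2.1)).hasFDerivAt.comp w
      (hB w hw).2.2.hasFDerivAt
  have hA : ∀ w ∈ ball (Φ u₀) ε, ∀ v, fderiv ℂ a (Ψ w) (fderiv ℂ Ψ w v) = v j := by
    intro w hw v
    have h1 := (ha.differentiableAt (hU.mem_nhds (hB w hw).2.1)).hasFDerivAt.comp w
      (hB w hw).2.2.hasFDerivAt
    have h2 : HasFDerivAt (a ∘ Ψ) (ContinuousLinearMap.proj j : (Fin r → ℂ) →L[ℂ] ℂ) w :=
      (hasFDerivAt_apply j w).congr_of_eventuallyEq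
        (eventually_of_mem (isOpen_ball.mem_nhds hw) haΨ)
    exact congrArg (fun L : (Fin r → ℂ) →L[ℂ] ℂ ↦ L v) (h1.unique h2)
  have hC : ∀ w ∈ ball (Φ u₀) ε, ∀ v : Fin r → ℂ, v j = 0 →
      fderiv ℂ (fun w ↦ c (Ψ w)) w v = 0 := by
    intro w hw v hv
    rw [(hcΨ w hw).fderiv]
    have h := mul_eq_mul_of_forall_single (hprop _ (hB w hw).2.1)
      (fderiv ℂ Ψ w (Pi.single j 1)) (fderiv ℂ Ψ w v)
    rw [hA w hw, hA w hw, hv] at h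
    simpa using h
  have hnhds : ∀ᶠ u in 𝓝 u₀, u ∈ U ∧ Ψ (Φ u) = u ∧ Φ u ∈ ball (Φ u₀) ε :=
    (hU.eventually_mem hu₀).and
      (hleft.and (hΦC.continuousAt.eventually_mem (ball_mem_nhds _ hε)))
  obtain ⟨V, hV, hVo, hV0⟩ := _root_.eventually_nhds_iff.1 hnhds
  refine ⟨V, hVo, hV0, fun u hu ↦ (hV u hu).1, ball (Φ u₀ j) ε, isOpen_ball, ?_,
    fun z ↦ c (Ψ (Function.update (Φ u₀) j z)), fun z hz ↦ ?_, fun u hu ↦ ?_⟩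
  · rintro _ ⟨u, hu, rfl⟩
    rw [← hΦj u]
    exact (dist_le_pi_dist _ _ j).trans_lt (hV u hu).2.2
  · exact ((hcΨ _ (update_mem_ball (mem_ball_self hε) hz)).comp z
      (hasFDerivAt_update (Φ u₀) z)).differentiableAt.differentiableWithinAt
  · have := eq_apply_update_of_fderiv_eq_zero (fun w hw ↦ (hcΨ w hw).differentiableAt) hC
      (hV u hu).2.2
    rwa [(hV u hu).2.1, hΦj] at this
end
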